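/- (Minimal LD^{R,G} calculation) For arbitrary tuples of lines H and G, an arbitrary neighborhood relation 𝒩 specifying for each ground-truth index x the set 𝒩(G_x) of hypothesis lines allowed to match G_x, and flattened sequences h = f(H), g = f(G), the geometry-restricted dynamic-programming value equals the reading-order- and geometry-constrained minimal Levenshtein distance: D^{R,G}(|h|,|g|) = LD^{R,G}(H,G). -/

import Mathlib

open scoped Classical

/-- The Levenshtein distance between two lists: the minimal number of single-character
insertions, deletions and substitutions transforming the first list into the second. -/
def lev {α : Type*} [DecidableEq α] : List α → List α → ℕ
  | [], ys => ys.length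
  | x :: xs, [] => (x :: xs).length
  | x :: xs, y :: ys =>
      min (lev xs ys + if x = y then 0 else 1)
        (min (lev xs (y :: ys) + 1) (lev (x :: xs) ys + 1))
  termination_by xs ys => xs.length + ys.length

/-- `A ∈ 𝒜`: a `{0,1}`-valued matrix in which every row and every column
contains at most one `1`. -/
def ValidA {N M : ℕ} (A : Fin N → Fin M → Bool) : Prop :=
  (∀ y x x', A y x = true → A y x' = true → x = x') ∧
  (∀ y y' x, A y x = true → A y' x = true → y = y')

/-- The reading-order condition defining `𝒜^R ⊆ 𝒜`: whenever `A_{y,x} = A_{y',x'} = 1`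
and `y < y'`, then `x < x'`. -/
def ReadOrder {N M : ℕ} (A : Fin N → Fin M → Bool) : Prop :=
  ∀ y y' x x', A y x = true → A y' x' = true → y < y' → x < x'

/-- The cost `Σ_{(y,x)∈W(A)} LD(H_y,G_x) + Σ_{y∈U(A)} |H_y| + Σ_{x∈V(A)} |G_x|`
associated with an assignment matrix `A` between the tuples of lines `H` and `G`. -/
def costA {α : Type*} [DecidableEq α] (H G : List (List α))
    (A : Fin H.length → Fin G.length → Bool) : ℕ :=
  (∑ p : Fin H.length × Fin G.length, if A p.1 p.2 = true then lev (H.get p.1) (G.get p.2) else 0)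
  + (∑ y : Fin H.length, if ∀ x, ¬ A y x = true then (H.get y).length else 0)
  + (∑ x : Fin G.length, if ∀ y, ¬ A y x = true then (G.get x).length else 0)

/-- The geometric condition defining `𝒜^G ⊆ 𝒜` for a neighborhood relation `Nbhd`
(`Nbhd x` is the set `𝒩(G_{x+1})` of hypothesis lines allowed to match the ground-truth
line of 0-based index `x`): `A_{y,x} = 1` implies `H_y ∈ 𝒩(G_x)`. -/
def Geo {α : Type*} (H G : List (List α)) (Nbhd : ℕ → Set (List α))
    (A : Fin H.length → Fin G.length → Bool) : Prop :=
  ∀ y x, A y x = true → H.get y ∈ Nbhd (x : ℕ)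

/-- `LD^{R,G}(H,G)`: the minimum of the cost over all valid assignment matrices that
respect the reading order and the geometric restriction. -/
noncomputable def LDRG {α : Type*} [DecidableEq α] (H G : List (List α))
    (Nbhd : ℕ → Set (List α)) : ℕ :=
  sInf {c : ℕ | ∃ A : Fin H.length → Fin G.length → Bool,
    ValidA A ∧ ReadOrder A ∧ Geo H G Nbhd A ∧ c = costA H G A}

/-- The flatten function `f`: the separator `↵ ∉ Σ` is modelled by `none`, characters of
`Σ = α` by `some a`; a separator is written before, between and after the lines. -/
def flat {α : Type*} (H : List (List α)) : List (Option α) :=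
  none :: H.flatMap (fun l => l.map some ++ [none])

/-- `h_i`, the `i`-th symbol (1-indexed) of a flattened sequence. -/
def nth {α : Type*} (h : List (Option α)) (i : ℕ) : Option α :=
  h.getD (i - 1) none

/-- `i` is a line-break position of `h` (1-indexed): `h_i = ↵`. -/
def isBrk {α : Type*} (h : List (Option α)) (i : ℕ) : Prop :=
  1 ≤ i ∧ i ≤ h.length ∧ nth h i = none

/-- `b_h^{y-1}` for `i = b_h^y`: the largest break position strictly below `i`
(`0` if there is none). -/
noncomputable def prevBrk {α : Type*} (h : List (Option α)) (i : ℕ) : ℕ :=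
  Nat.findGreatest (fun k => isBrk h k) (i - 1)

/-- The index `y` such that `i = b_h^y` (the number of break positions `≤ i`). -/
noncomputable def brkIdx {α : Type*} (h : List (Option α)) (i : ℕ) : ℕ :=
  ((List.range i).filter (fun k => decide (isBrk h (k + 1)))).length

/-- `d^R(i,j)`: `0` if `h_i = g_j`; `1` if `h_i ≠ g_j` and both `h_i, g_j ∈ Σ`;
`∞` otherwise. -/
noncomputable def dR {α : Type*} (h g : List (Option α)) (i j : ℕ) : ℕ∞ :=
  if nth h i = nth g j then 0
  else if nth h i ≠ none ∧ nth g j ≠ none then 1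
  else ⊤

/-- The dynamic program `D^{R,G}(i,j)` for `h = f(H)` and `g = f(G)`:
`D^{R,G}(0,0) = 0`, `D^{R,G}(i,0) = i`, `D^{R,G}(0,j) = j`; at pairs of break positions
`(i,j) = (b_h^y, b_g^x)`,
`D^{R,G}(i,j) = min{ D^{R,G}(i−1,j−1) allowed only if y,x ≥ 2 implies
H_{y−1} ∈ 𝒩(G_{x−1}); D^{R,G}(b_h^{y−1},j) + |H_{y−1}| if y ≥ 2;
D^{R,G}(i,b_g^{x−1}) + |G_{x−1}| if x ≥ 2 }`; at all other pairs,
`D^{R,G}(i,j) = min{ D^{R,G}(i−1,j−1) + d^R(i,j); D^{R,G}(i−1,j) + 1 if h_i ≠ ↵;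
D^{R,G}(i,j−1) + 1 if g_j ≠ ↵ }`. -/
noncomputable def DRG {α : Type*} (H G : List (List α)) (Nbhd : ℕ → Set (List α)) :
    ℕ → ℕ → ℕ∞
  | 0, 0 => 0
  | i + 1, 0 => (i + 1 : ℕ)
  | 0, j + 1 => (j + 1 : ℕ)
  | i + 1, j + 1 =>
    if isBrk (flat H) (i + 1) ∧ isBrk (flat G) (j + 1) then
      min
        (if (2 ≤ brkIdx (flat H) (i + 1) ∧ 2 ≤ brkIdx (flat G) (j + 1)) →
              H.getD (brkIdx (flat H) (i + 1) - 2) [] ∈ Nbhd (brkIdx (flat G) (j + 1) - 2)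
          then DRG H G Nbhd i j else ⊤) <| min
        (if 2 ≤ brkIdx (flat H) (i + 1) then
            DRG H G Nbhd (prevBrk (flat H) (i + 1)) (j + 1)
              + ((H.getD (brkIdx (flat H) (i + 1) - 2) []).length : ℕ∞)
          else ⊤)
        (if 2 ≤ brkIdx (flat G) (j + 1) then
            DRG H G Nbhd (i + 1) (prevBrk (flat G) (j + 1))
              + ((G.getD (brkIdx (flat G) (j + 1) - 2) []).length : ℕ∞)
          else ⊤)
    else
      min (DRG H G Nbhd i j + dR (flat H) (flat G) (i + 1) (j + 1)) <| min
        (if nth (flat H) (i + 1) ≠ none then DRG H G Nbhd i (j + 1) + 1 else ⊤)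
        (if nth (flat G) (j + 1) ≠ none then DRG H G Nbhd (i + 1) j + 1 else ⊤)
  termination_by i j => i + j
  decreasing_by
  · omega
  · have := Nat.findGreatest_le (P := fun k => isBrk (flat H) k) (i + 1 - 1)
    unfold prevBrk
    omega
  · have := Nat.findGreatest_le (P := fun k => isBrk (flat G) k) (j + 1 - 1)
    unfold prevBrk
    omega
  · omega
  · omega
  · omega

/-! ### The Levenshtein distance is invariant under reversal -/

/-- `EditScript xs ys n`: some sequence of edits of total cost `n` transforms `xs` into `ys`. -/
inductive EditScript {α : Type*} [DecidableEq α] : List α → List α → ℕ → Prop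
  | nil : EditScript [] [] 0
  | sub {xs ys n} (x y : α) : EditScript xs ys n →
      EditScript (x :: xs) (y :: ys) (n + if x = y then 0 else 1)
  | del {xs ys n} (x : α) : EditScript xs ys n → EditScript (x :: xs) ys (n + 1)
  | ins {xs ys n} (y : α) : EditScript xs ys n → EditScript xs (y :: ys) (n + 1)

section Lev

variable {α : Type*} [DecidableEq α]

theorem lev_nil_left (ys : List α) : lev [] ys = ys.length := by rw [lev]

theorem lev_nil_right (xs : List α) : lev xs [] = xs.length := by
  cases xs <;> rw [lev]

theorem lev_cons_cons (x y : α) (xs ys : List α) :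
    lev (x :: xs) (y :: ys) = min (lev xs ys + if x = y then 0 else 1)
      (min (lev xs (y :: ys) + 1) (lev (x :: xs) ys + 1)) := by
  rw [lev]

theorem EditScript.insAll (ys : List α) : EditScript [] ys ys.length := by
  induction ys with
  | nil => exact .nil
  | cons y ys ih => exact .ins y ih

theorem EditScript.delAll (xs : List α) : EditScript xs [] xs.length := by
  induction xs with
  | nil => exact .nil
  | cons x xs ih => exact .del x ih

theorem EditScript.append {xs ys xs' ys' : List α} {n m : ℕ} (h : EditScript xs ys n)
    (h' : EditScript xs' ys' m) : EditScript (xs ++ xs') (ys ++ ys') (n + m) := by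
  induction h with
  | nil => simpa using h'
  | sub x y _ ih => rw [add_right_comm]; exact ih.sub x y
  | del x _ ih => rw [add_right_comm]; exact ih.del x
  | ins y _ ih => rw [add_right_comm]; exact ih.ins y

theorem EditScript.reverse {xs ys : List α} {n : ℕ} (h : EditScript xs ys n) :
    EditScript xs.reverse ys.reverse n := by
  induction h with
  | nil => exact .nil
  | sub x y _ ih => simpa using ih.append (EditScript.nil.sub x y)
  | del x _ ih => simpa using ih.append (EditScript.nil.del x)
  | ins y _ ih => simpa using ih.append (EditScript.nil.ins y)

theorem editScript_lev : ∀ xs ys : List α, EditScript xs ys (lev xs ys)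
  | [], ys => by rw [lev_nil_left]; exact .insAll ys
  | x :: xs, [] => by rw [lev_nil_right]; exact .delAll _
  | x :: xs, y :: ys => by
    rw [lev_cons_cons]
    rcases min_choice (lev xs ys + if x = y then 0 else 1)
      (min (lev xs (y :: ys) + 1) (lev (x :: xs) ys + 1)) with h | h
    · rw [h]; exact (editScript_lev xs ys).sub x y
    · rw [h]
      rcases min_choice (lev xs (y :: ys) + 1) (lev (x :: xs) ys + 1) with h | h
      · rw [h]; exact (editScript_lev xs (y :: ys)).del x
      · rw [h]; exact (editScript_lev (x :: xs) ys).ins y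
  termination_by xs ys => xs.length + ys.length

theorem EditScript.lev_le {xs ys : List α} {n : ℕ} (h : EditScript xs ys n) : lev xs ys ≤ n := by
  induction h with
  | nil => simp [lev_nil_left]
  | sub x y _ ih => rw [lev_cons_cons]; omega
  | @del xs ys n x _ ih =>
    cases ys with
    | nil => simpa [lev_nil_right] using ih
    | cons y ys => rw [lev_cons_cons]; omega
  | @ins xs ys n y _ ih =>
    cases xs with
    | nil => simpa [lev_nil_left] using ih
    | cons x xs => rw [lev_cons_cons]; omega

theorem lev_reverse (xs ys : List α) : lev xs.reverse ys.reverse = lev xs ys :=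
  le_antisymm (editScript_lev xs ys).reverse.lev_le
    (by simpa using (editScript_lev xs.reverse ys.reverse).reverse.lev_le)

theorem lev_concat_concat (x y : α) (xs ys : List α) :
    lev (xs ++ [x]) (ys ++ [y]) = min (lev xs ys + if x = y then 0 else 1)
      (min (lev xs (ys ++ [y]) + 1) (lev (xs ++ [x]) ys + 1)) := by
  rw [← lev_reverse xs ys, ← lev_reverse xs (ys ++ [y]), ← lev_reverse (xs ++ [x]) ys,
    ← lev_reverse (xs ++ [x])]
  simp [lev_cons_cons]

end Lev

/-! ### Optimal monotone alignments of two index ranges -/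

/-- The dynamic program for the cheapest monotone partial matching between `{0, …, y - 1}` and
`{0, …, x - 1}`, where matching `i` with `j` requires `P i j` and costs `c i j`, and leaving `i`
or `j` unmatched costs `u i` or `v j`. -/
noncomputable def alignCost (P : ℕ → ℕ → Prop) (c : ℕ → ℕ → ℕ) (u v : ℕ → ℕ) : ℕ → ℕ → ℕ
  | 0, 0 => 0
  | y + 1, 0 => alignCost P c u v y 0 + u y
  | 0, x + 1 => alignCost P c u v 0 x + v x
  | y + 1, x + 1 =>
    min (if P y x then alignCost P c u v y x + c y x else alignCost P c u v y (x + 1) + u y)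
      (min (alignCost P c u v y (x + 1) + u y) (alignCost P c u v (y + 1) x + v x))
  termination_by y x => y + x

/-- The cost of the partial matching `A` restricted to `{0, …, y - 1} × {0, …, x - 1}`. -/
noncomputable def matchCost (c : ℕ → ℕ → ℕ) (u v : ℕ → ℕ) (A : ℕ → ℕ → Prop) (y x : ℕ) : ℕ :=
  (∑ i ∈ Finset.range y, ∑ j ∈ Finset.range x, if A i j then c i j else 0)
  + (∑ i ∈ Finset.range y, if ∀ j < x, ¬ A i j then u i else 0)
  + (∑ j ∈ Finset.range x, if ∀ i < y, ¬ A i j then v j else 0)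

/-- `A` is a monotone partial matching all of whose pairs satisfy `P`. -/
structure MonoMatching (P : ℕ → ℕ → Prop) (A : ℕ → ℕ → Prop) : Prop where
  row : ∀ i j j', A i j → A i j' → j = j'
  col : ∀ i i' j, A i j → A i' j → i = i'
  mono : ∀ i i' j j', A i j → A i' j' → i < i' → j < j'
  allowed : ∀ i j, A i j → P i j

section Align

variable {P : ℕ → ℕ → Prop} {c : ℕ → ℕ → ℕ} {u v : ℕ → ℕ} {A B : ℕ → ℕ → Prop} {y x : ℕ}

theorem matchCost_congr (h : ∀ i < y, ∀ j < x, (A i j ↔ B i j)) :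
    matchCost c u v A y x = matchCost c u v B y x := by
  unfold matchCost
  congr 1
  · congr 1
    · refine Finset.sum_congr rfl fun i hi => Finset.sum_congr rfl fun j hj => ?_
      exact if_congr (h i (by simpa using hi) j (by simpa using hj)) rfl rfl
    · refine Finset.sum_congr rfl fun i hi => if_congr ?_ rfl rfl
      exact forall₂_congr fun j hj => not_congr (h i (by simpa using hi) j hj)
  · refine Finset.sum_congr rfl fun j hj => if_congr ?_ rfl rfl
    exact forall₂_congr fun i hi => not_congr (h i hi j (by simpa using hj))

theorem matchCost_succ_left (h : ∀ j < x, ¬ A y j) :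
    matchCost c u v A (y + 1) x = matchCost c u v A y x + u y := by
  unfold matchCost
  have h1 : ∑ j ∈ Finset.range x, (if A y j then c y j else 0) = 0 :=
    Finset.sum_eq_zero fun j hj => if_neg (h j (by simpa using hj))
  have h2 : ∑ j ∈ Finset.range x, (if ∀ i < y + 1, ¬ A i j then v j else 0)
      = ∑ j ∈ Finset.range x, (if ∀ i < y, ¬ A i j then v j else 0) := by
    refine Finset.sum_congr rfl fun j hj => if_congr ?_ rfl rfl
    simp only [Nat.forall_lt_succ_right, h j (by simpa using hj), not_false_eq_true, and_true]
  rw [Finset.sum_range_succ, Finset.sum_range_succ, h1, h2, if_pos h]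
  ring

theorem matchCost_succ_right (h : ∀ i < y, ¬ A i x) :
    matchCost c u v A y (x + 1) = matchCost c u v A y x + v x := by
  unfold matchCost
  have h1 : ∑ i ∈ Finset.range y, (if A i x then c i x else 0) = 0 :=
    Finset.sum_eq_zero fun i hi => if_neg (h i (by simpa using hi))
  have h2 : ∑ i ∈ Finset.range y, (if ∀ j < x + 1, ¬ A i j then u i else 0)
      = ∑ i ∈ Finset.range y, (if ∀ j < x, ¬ A i j then u i else 0) := by
    refine Finset.sum_congr rfl fun i hi => if_congr ?_ rfl rfl
    simp only [Nat.forall_lt_succ_right, h i (by simpa using hi), not_false_eq_true, and_true]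
  simp only [Finset.sum_range_succ, Finset.sum_add_distrib]
  rw [h1, h2, if_pos h]
  ring

theorem matchCost_succ_succ (hA : A y x) (hrow : ∀ j < x, ¬ A y j) (hcol : ∀ i < y, ¬ A i x) :
    matchCost c u v A (y + 1) (x + 1) = matchCost c u v A y x + c y x := by
  unfold matchCost
  have h1 : ∑ j ∈ Finset.range x, (if A y j then c y j else 0) = 0 :=
    Finset.sum_eq_zero fun j hj => if_neg (hrow j (by simpa using hj))
  have h1' : ∑ i ∈ Finset.range y, (if A i x then c i x else 0) = 0 :=
    Finset.sum_eq_zero fun i hi => if_neg (hcol i (by simpa using hi))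
  have h2 : ∑ j ∈ Finset.range x, (if ∀ i < y + 1, ¬ A i j then v j else 0)
      = ∑ j ∈ Finset.range x, (if ∀ i < y, ¬ A i j then v j else 0) := by
    refine Finset.sum_congr rfl fun j hj => if_congr ?_ rfl rfl
    simp only [Nat.forall_lt_succ_right, hrow j (by simpa using hj), not_false_eq_true, and_true]
  have h3 : ∑ i ∈ Finset.range y, (if ∀ j < x + 1, ¬ A i j then u i else 0)
      = ∑ i ∈ Finset.range y, (if ∀ j < x, ¬ A i j then u i else 0) := by
    refine Finset.sum_congr rfl fun i hi => if_congr ?_ rfl rfl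
    simp only [Nat.forall_lt_succ_right, hcol i (by simpa using hi), not_false_eq_true, and_true]
  have h4 : ¬ ∀ j < x + 1, ¬ A y j := fun h => h x (by omega) hA
  have h5 : ¬ ∀ i < y + 1, ¬ A i x := fun h => h y (by omega) hA
  simp only [Finset.sum_range_succ _ y, Finset.sum_range_succ _ x, Finset.sum_add_distrib]
  rw [h1, h1', h2, h3, if_neg h4, if_neg h5, if_pos hA]
  ring

theorem alignCost_le_matchCost (hA : MonoMatching P A) :
    ∀ y x, alignCost P c u v y x ≤ matchCost c u v A y x
  | 0, 0 => by rw [alignCost]; exact Nat.zero_le _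
  | y + 1, 0 => by
    rw [alignCost, matchCost_succ_left (by simp)]
    exact Nat.add_le_add_right (alignCost_le_matchCost hA y 0) _
  | 0, x + 1 => by
    rw [alignCost, matchCost_succ_right (by simp)]
    exact Nat.add_le_add_right (alignCost_le_matchCost hA 0 x) _
  | y + 1, x + 1 => by
    have ih1 := alignCost_le_matchCost hA y x
    have ih2 := alignCost_le_matchCost hA y (x + 1)
    have ih3 := alignCost_le_matchCost hA (y + 1) x
    rw [alignCost]
    by_cases hyx : A y x
    · rw [if_pos (hA.allowed _ _ hyx), matchCost_succ_succ hyx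
        (fun j hj h => hj.ne (hA.row _ _ _ h hyx)) (fun i hi h => hi.ne (hA.col _ _ _ h hyx))]
      omega
    · by_cases hrow : ∀ j < x + 1, ¬ A y j
      · rw [matchCost_succ_left hrow]
        omega
      · have hcol : ∀ i < y + 1, ¬ A i x := by
          push Not at hrow
          obtain ⟨j, hj, hyj⟩ := hrow
          intro i hi hix
          rcases Nat.lt_succ_iff_lt_or_eq.mp hi with h | rfl
          · have := hA.mono _ _ _ _ hix hyj h
            omega
          · exact hyx hix
        rw [matchCost_succ_right hcol]
        omega
  termination_by y x => y + x

theorem exists_matchCost_eq_alignCost (P : ℕ → ℕ → Prop) (c : ℕ → ℕ → ℕ) (u v : ℕ → ℕ) :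
    ∀ y x, ∃ A, MonoMatching P A ∧ (∀ i j, A i j → i < y ∧ j < x) ∧
      matchCost c u v A y x = alignCost P c u v y x
  | 0, 0 => ⟨fun _ _ => False, ⟨by simp, by simp, by simp, by simp⟩, by simp,
      by simp [matchCost, alignCost]⟩
  | y + 1, 0 => by
    obtain ⟨A, hA, hs, h⟩ := exists_matchCost_eq_alignCost P c u v y 0
    refine ⟨A, hA, fun i j hij => by have := hs i j hij; omega, ?_⟩
    rw [alignCost, matchCost_succ_left (by simp), h]
  | 0, x + 1 => by
    obtain ⟨A, hA, hs, h⟩ := exists_matchCost_eq_alignCost P c u v 0 x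
    refine ⟨A, hA, fun i j hij => by have := hs i j hij; omega, ?_⟩
    rw [alignCost, matchCost_succ_right (by simp), h]
  | y + 1, x + 1 => by
    have skip_row : ∃ A, MonoMatching P A ∧ (∀ i j, A i j → i < y + 1 ∧ j < x + 1) ∧
        matchCost c u v A (y + 1) (x + 1) = alignCost P c u v y (x + 1) + u y := by
      obtain ⟨A, hA, hs, h⟩ := exists_matchCost_eq_alignCost P c u v y (x + 1)
      refine ⟨A, hA, fun i j hij => by have := hs i j hij; omega, ?_⟩
      rw [matchCost_succ_left fun j _ h => (hs _ _ h).1.false, h]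
    have skip_col : ∃ A, MonoMatching P A ∧ (∀ i j, A i j → i < y + 1 ∧ j < x + 1) ∧
        matchCost c u v A (y + 1) (x + 1) = alignCost P c u v (y + 1) x + v x := by
      obtain ⟨A, hA, hs, h⟩ := exists_matchCost_eq_alignCost P c u v (y + 1) x
      refine ⟨A, hA, fun i j hij => by have := hs i j hij; omega, ?_⟩
      rw [matchCost_succ_right fun j _ h => (hs _ _ h).2.false, h]
    have use_first : ∃ A, MonoMatching P A ∧ (∀ i j, A i j → i < y + 1 ∧ j < x + 1) ∧
        matchCost c u v A (y + 1) (x + 1) = if P y x then alignCost P c u v y x + c y x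
          else alignCost P c u v y (x + 1) + u y := by
      split_ifs with hP
      · obtain ⟨A, hA, hs, h⟩ := exists_matchCost_eq_alignCost P c u v y x
        refine ⟨fun i j => A i j ∨ i = y ∧ j = x, ⟨?_, ?_, ?_, ?_⟩, ?_, ?_⟩
        · rintro i j j' (h1 | ⟨rfl, rfl⟩) (h2 | ⟨h2, h2'⟩)
          · exact hA.row _ _ _ h1 h2
          · have := hs _ _ h1; omega
          · have := hs _ _ h2; omega
          · exact h2'.symm
        · rintro i i' j (h1 | ⟨rfl, rfl⟩) (h2 | ⟨h2, h2'⟩)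
          · exact hA.col _ _ _ h1 h2
          · have := hs _ _ h1; omega
          · have := hs _ _ h2; omega
          · exact h2.symm
        · rintro i i' j j' (h1 | ⟨rfl, rfl⟩) (h2 | ⟨h2, h2'⟩) hlt
          · exact hA.mono _ _ _ _ h1 h2 hlt
          · have := hs _ _ h1; omega
          · have := hs _ _ h2; omega
          · omega
        · rintro i j (h1 | ⟨rfl, rfl⟩)
          · exact hA.allowed _ _ h1
          · exact hP
        · rintro i j (h1 | ⟨rfl, rfl⟩)
          · have := hs _ _ h1; omega
          · omega
        · rw [matchCost_succ_succ (by simp), ← h]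
          · congr 1
            exact matchCost_congr fun i hi j hj => by
              simp only [or_iff_left_iff_imp]; omega
          · rintro j hj (h1 | h1)
            · have := hs _ _ h1; omega
            · omega
          · rintro j hj (h1 | h1)
            · have := hs _ _ h1; omega
            · omega
      · exact skip_row
    rw [alignCost]
    rcases min_choice (if P y x then alignCost P c u v y x + c y x
      else alignCost P c u v y (x + 1) + u y)
      (min (alignCost P c u v y (x + 1) + u y) (alignCost P c u v (y + 1) x + v x)) with h | h
    · rw [h]; exact use_first
    · rw [h]
      rcases min_choice (alignCost P c u v y (x + 1) + u y)
        (alignCost P c u v (y + 1) x + v x) with h | h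
      · rw [h]; exact skip_row
      · rw [h]; exact skip_col
  termination_by y x => y + x

end Align

section Lines

variable {α : Type*}

/-- `alignCost` for aligning the lines of `H` with the lines of `G`. -/
noncomputable def lineAlignCost [DecidableEq α] (H G : List (List α)) (Nbhd : ℕ → Set (List α)) :
    ℕ → ℕ → ℕ :=
  alignCost (fun y x => H.getD y [] ∈ Nbhd x) (fun y x => lev (H.getD y []) (G.getD x []))
    (fun y => (H.getD y []).length) (fun x => (G.getD x []).length)

theorem costA_eq_matchCost [DecidableEq α] (H G : List (List α))
    (A : Fin H.length → Fin G.length → Bool) (B : ℕ → ℕ → Prop)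
    (hB : ∀ y x, B y x ↔ ∃ (hy : y < H.length) (hx : x < G.length), A ⟨y, hy⟩ ⟨x, hx⟩ = true) :
    costA H G A = matchCost (fun y x => lev (H.getD y []) (G.getD x []))
      (fun y => (H.getD y []).length) (fun x => (G.getD x []).length) B H.length G.length := by
  have hB' : ∀ (y : Fin H.length) (x : Fin G.length), B y x ↔ A y x = true := fun y x => by
    rw [hB]; exact ⟨fun ⟨_, _, h⟩ => h, fun h => ⟨y.2, x.2, h⟩⟩
  unfold costA matchCost
  simp only [Finset.sum_range, Fintype.sum_prod_type]
  congr 1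
  · congr 1
    · refine Finset.sum_congr rfl fun y _ => Finset.sum_congr rfl fun x _ => ?_
      simp only [hB', List.get_eq_getElem, List.getD_eq_getElem _ _ y.2,
        List.getD_eq_getElem _ _ x.2]
    · refine Finset.sum_congr rfl fun y _ => ?_
      refine if_congr ?_ (by simp) rfl
      simp only [← hB']
      exact ⟨fun h j hj => h ⟨j, hj⟩, fun h x => h x x.2⟩
  · refine Finset.sum_congr rfl fun x _ => ?_
    refine if_congr ?_ (by simp) rfl
    simp only [← hB']
    exact ⟨fun h j hj => h ⟨j, hj⟩, fun h y => h y y.2⟩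

theorem LDRG_eq_lineAlignCost [DecidableEq α] (H G : List (List α)) (Nbhd : ℕ → Set (List α)) :
    LDRG H G Nbhd = lineAlignCost H G Nbhd H.length G.length := by
  refine IsLeast.csInf_eq ⟨?_, ?_⟩
  · obtain ⟨B, hB, hs, h⟩ := exists_matchCost_eq_alignCost (fun y x => H.getD y [] ∈ Nbhd x)
      (fun y x => lev (H.getD y []) (G.getD x [])) (fun y => (H.getD y []).length)
      (fun x => (G.getD x []).length) H.length G.length
    refine ⟨fun y x => decide (B y x), ⟨?_, ?_⟩, ?_, ?_, ?_⟩
    · intro y x x' h1 h2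
      exact Fin.ext (hB.row _ _ _ (of_decide_eq_true h1) (of_decide_eq_true h2))
    · intro y y' x h1 h2
      exact Fin.ext (hB.col _ _ _ (of_decide_eq_true h1) (of_decide_eq_true h2))
    · intro y y' x x' h1 h2 hlt
      exact hB.mono _ _ _ _ (of_decide_eq_true h1) (of_decide_eq_true h2) hlt
    · intro y x h1
      simpa using hB.allowed _ _ (of_decide_eq_true h1)
    · rw [costA_eq_matchCost H G _ B, h, lineAlignCost]
      intro y x
      simp only [decide_eq_true_eq, exists_prop]
      exact ⟨fun h => ⟨(hs _ _ h).1, (hs _ _ h).2, h⟩, fun h => h.2.2⟩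
  · rintro _ ⟨A, ⟨hr, hc⟩, hm, hg, rfl⟩
    rw [costA_eq_matchCost H G A _ fun _ _ => Iff.rfl]
    refine alignCost_le_matchCost ⟨?_, ?_, ?_, ?_⟩ _ _
    · rintro i j j' ⟨_, _, h⟩ ⟨_, _, h'⟩
      simpa using hr _ _ _ h h'
    · rintro i i' j ⟨_, _, h⟩ ⟨_, _, h'⟩
      simpa using hc _ _ _ h h'
    · rintro i i' j j' ⟨_, _, h⟩ ⟨_, _, h'⟩ hlt
      simpa using hm _ _ _ _ h h' hlt
    · rintro i j ⟨hi, _, h⟩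
      rw [List.getD_eq_getElem _ _ hi]
      exact hg _ _ h

/-! ### Break positions of a flattened tuple of lines -/

/-- The 0-based position in `flat H` of the separator preceding the line with index `y`. -/
def brkPos (H : List (List α)) (y : ℕ) : ℕ :=
  ∑ i ∈ Finset.range y, ((H.getD i []).length + 1)

theorem brkPos_succ (H : List (List α)) (y : ℕ) :
    brkPos H (y + 1) = brkPos H y + (H.getD y []).length + 1 := by
  rw [brkPos, Finset.sum_range_succ, brkPos, add_assoc]

theorem flat_append (H K : List (List α)) :
    flat (H ++ K) = flat H ++ K.flatMap (fun l => l.map some ++ [none]) := by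
  simp [flat]

theorem length_flat_take (H : List (List α)) :
    ∀ y ≤ H.length, (flat (H.take y)).length = brkPos H y + 1
  | 0, _ => by simp [flat, brkPos]
  | y + 1, hy => by
    rw [List.take_succ_eq_append_getElem hy, flat_append, List.length_append,
      length_flat_take H y (by omega), brkPos_succ, List.getD_eq_getElem _ _ hy]
    simp
    omega

theorem length_flat (H : List (List α)) : (flat H).length = brkPos H H.length + 1 := by
  simpa using length_flat_take H H.length le_rfl

theorem flat_getD (H : List (List α)) {y a : ℕ} (hy : y < H.length)
    (ha : a ≤ (H.getD y []).length) :
    (flat H).getD (brkPos H y + a + 1) none = (H.getD y [])[a]? := by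
  have hflat : flat H = flat (H.take y) ++ ((H.getD y []).map some ++ none ::
      (H.drop (y + 1)).flatMap (fun l => l.map some ++ [none])) := by
    conv_lhs => rw [← List.take_append_drop y H, flat_append, List.drop_eq_getElem_cons hy]
    rw [List.getD_eq_getElem _ _ hy, List.flatMap_cons, List.append_assoc, List.singleton_append]
  have hlen := length_flat_take H y hy.le
  rw [hflat, List.getD_append_right _ _ _ _ (by omega), hlen,
    show brkPos H y + a + 1 - (brkPos H y + 1) = a by omega]
  rcases ha.lt_or_eq with h | rfl
  · rw [List.getD_append _ _ _ _ (by simpa using h)]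
    rw [List.getD_eq_getElem _ _ (by simpa using h), List.getElem_map, List.getElem?_eq_getElem h]
  · rw [List.getD_append_right _ _ _ _ (by simp)]
    simp

theorem nth_flat_brk (H : List (List α)) {y : ℕ} (hy : y ≤ H.length) :
    nth (flat H) (brkPos H y + 1) = none := by
  cases y with
  | zero => simp [nth, flat, brkPos]
  | succ y =>
    rw [nth, Nat.add_sub_cancel, brkPos_succ, flat_getD H hy le_rfl]
    simp

theorem nth_flat_interior (H : List (List α)) {y a : ℕ} (hy : y < H.length)
    (ha : a < (H.getD y []).length) :
    nth (flat H) (brkPos H y + a + 1 + 1) = some (H.getD y [])[a] := by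
  rw [nth, Nat.add_sub_cancel, flat_getD H hy ha.le, List.getElem?_eq_getElem ha]

theorem brkPos_mono (H : List (List α)) : Monotone (brkPos H) :=
  monotone_nat_of_le_succ fun y => by rw [brkPos_succ]; omega

theorem isBrk_flat (H : List (List α)) {y : ℕ} (hy : y ≤ H.length) :
    isBrk (flat H) (brkPos H y + 1) := by
  refine ⟨by omega, ?_, nth_flat_brk H hy⟩
  have := brkPos_mono H hy
  rw [length_flat]
  omega

theorem not_isBrk_flat (H : List (List α)) {y a : ℕ} (hy : y < H.length)
    (ha : a < (H.getD y []).length) : ¬ isBrk (flat H) (brkPos H y + a + 1 + 1) := by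
  rintro ⟨-, -, h⟩
  simp [nth_flat_interior H hy ha] at h

theorem prevBrk_flat (H : List (List α)) {y : ℕ} (hy : y < H.length) :
    prevBrk (flat H) (brkPos H (y + 1) + 1) = brkPos H y + 1 := by
  rw [prevBrk, Nat.findGreatest_eq_iff, brkPos_succ]
  refine ⟨by omega, fun _ => isBrk_flat H hy.le, fun {n} h1 h2 => ?_⟩
  obtain ⟨a, rfl⟩ := Nat.exists_eq_add_of_lt h1
  rw [show brkPos H y + 1 + a + 1 = brkPos H y + a + 1 + 1 by omega]
  exact not_isBrk_flat H hy (by omega)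

theorem brkIdx_succ (h : List (Option α)) (i : ℕ) :
    brkIdx h (i + 1) = brkIdx h i + if isBrk h (i + 1) then 1 else 0 := by
  rw [brkIdx, List.range_succ, List.filter_append, List.length_append, brkIdx]
  by_cases hb : isBrk h (i + 1) <;> simp [hb]

theorem brkIdx_flat (H : List (List α)) :
    ∀ y ≤ H.length, brkIdx (flat H) (brkPos H y + 1) = y + 1
  | 0, _ => by
    rw [brkIdx_succ, if_pos (isBrk_flat H (Nat.zero_le _))]
    simp [brkPos, brkIdx]
  | y + 1, hy => by
    have key : ∀ a ≤ (H.getD y []).length, brkIdx (flat H) (brkPos H y + a + 1) = y + 1 := by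
      intro a
      induction a with
      | zero => exact fun _ => brkIdx_flat H y (by omega)
      | succ a ih =>
        intro ha
        rw [← add_assoc, brkIdx_succ, if_neg (not_isBrk_flat H hy ha), ih (by omega)]
    rw [brkIdx_succ, if_pos (isBrk_flat H hy), brkPos_succ, key _ le_rfl]

/-! ### The dynamic program on flattened sequences -/

theorem DRG_zero_left (H G : List (List α)) (Nbhd : ℕ → Set (List α)) (j : ℕ) :
    DRG H G Nbhd 0 j = j := by
  cases j <;> simp [DRG]

theorem DRG_zero_right (H G : List (List α)) (Nbhd : ℕ → Set (List α)) (i : ℕ) :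
    DRG H G Nbhd i 0 = i := by
  cases i <;> simp [DRG]

theorem DRG_of_not_isBrk (H G : List (List α)) (Nbhd : ℕ → Set (List α)) {i j : ℕ}
    (h : ¬ (isBrk (flat H) (i + 1) ∧ isBrk (flat G) (j + 1))) :
    DRG H G Nbhd (i + 1) (j + 1) =
      min (DRG H G Nbhd i j + dR (flat H) (flat G) (i + 1) (j + 1)) (min
        (if nth (flat H) (i + 1) ≠ none then DRG H G Nbhd i (j + 1) + 1 else ⊤)
        (if nth (flat G) (j + 1) ≠ none then DRG H G Nbhd (i + 1) j + 1 else ⊤)) := by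
  rw [DRG, if_neg h]

theorem DRG_brkPos (H G : List (List α)) (Nbhd : ℕ → Set (List α)) {y x : ℕ}
    (hy : y ≤ H.length) (hx : x ≤ G.length) :
    DRG H G Nbhd (brkPos H y + 1) (brkPos G x + 1) = min
        (if (1 ≤ y ∧ 1 ≤ x) → H.getD (y - 1) [] ∈ Nbhd (x - 1)
          then DRG H G Nbhd (brkPos H y) (brkPos G x) else ⊤) (min
        (if 1 ≤ y then
            DRG H G Nbhd (prevBrk (flat H) (brkPos H y + 1)) (brkPos G x + 1)
              + ((H.getD (y - 1) []).length : ℕ∞)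
          else ⊤)
        (if 1 ≤ x then
            DRG H G Nbhd (brkPos H y + 1) (prevBrk (flat G) (brkPos G x + 1))
              + ((G.getD (x - 1) []).length : ℕ∞)
          else ⊤)) := by
  rw [DRG, if_pos ⟨isBrk_flat H hy, isBrk_flat G hx⟩, brkIdx_flat H y hy, brkIdx_flat G x hx]
  simp only [Nat.reduceLeDiff, Nat.reduceSubDiff]

theorem DRG_interior [DecidableEq α] (H G : List (List α)) (Nbhd : ℕ → Set (List α)) {y x : ℕ}
    (hy : y < H.length) (hx : x < G.length) :
    ∀ a b, a ≤ (H.getD y []).length → b ≤ (G.getD x []).length →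
      DRG H G Nbhd (brkPos H y + a + 1) (brkPos G x + b + 1) =
        DRG H G Nbhd (brkPos H y + 1) (brkPos G x + 1)
          + (lev ((H.getD y []).take a) ((G.getD x []).take b) : ℕ∞)
  | 0, 0, _, _ => by simp [lev_nil_left]
  | a + 1, 0, ha, hb => by
    have h1 := nth_flat_interior H hy ha
    have h2 := nth_flat_brk G hx.le
    have ih := DRG_interior H G Nbhd hy hx a 0 (by omega) hb
    rw [add_zero] at ih ⊢
    rw [← add_assoc, DRG_of_not_isBrk H G Nbhd fun h => not_isBrk_flat H hy ha h.1, h1, h2, dR,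
      h1, h2, ih, List.take_zero, lev_nil_right, lev_nil_right, List.length_take_of_le ha,
      List.length_take_of_le (Nat.le_of_succ_le ha)]
    simp [add_assoc]
  | 0, b + 1, ha, hb => by
    have h1 := nth_flat_interior G hx hb
    have h2 := nth_flat_brk H hy.le
    have ih := DRG_interior H G Nbhd hy hx 0 b ha (by omega)
    rw [add_zero] at ih ⊢
    rw [← add_assoc, DRG_of_not_isBrk H G Nbhd fun h => not_isBrk_flat G hx hb h.2, h1, h2, dR,
      h1, h2, ih, List.take_zero, lev_nil_left, lev_nil_left, List.length_take_of_le hb,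
      List.length_take_of_le (Nat.le_of_succ_le hb)]
    simp [add_assoc]
  | a + 1, b + 1, ha, hb => by
    have h1 := nth_flat_interior H hy ha
    have h2 := nth_flat_interior G hx hb
    have ih1 := DRG_interior H G Nbhd hy hx a b (by omega) (by omega)
    have ih2 := DRG_interior H G Nbhd hy hx a (b + 1) (by omega) hb
    have ih3 := DRG_interior H G Nbhd hy hx (a + 1) b ha (by omega)
    rw [← add_assoc] at ih2 ih3
    have hd : dR (flat H) (flat G) (brkPos H y + a + 1 + 1) (brkPos G x + b + 1 + 1)
        = ((if (H.getD y [])[a] = (G.getD x [])[b] then 0 else 1 : ℕ) : ℕ∞) := by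
      rw [dR, h1, h2]
      simp only [Option.some.injEq, ne_eq, reduceCtorEq, not_false_eq_true, and_self, if_true]
      split_ifs <;> rfl
    rw [← add_assoc, ← add_assoc, DRG_of_not_isBrk H G Nbhd fun h => not_isBrk_flat H hy ha h.1,
      hd, h1, h2, ih1, ih2, ih3, if_pos (Option.some_ne_none _), if_pos (Option.some_ne_none _),
      List.take_succ_eq_append_getElem ha, List.take_succ_eq_append_getElem hb,
      lev_concat_concat, Nat.mono_cast.map_min, Nat.mono_cast.map_min, ← min_add_add_left,
      ← min_add_add_left]
    push_cast
    simp only [add_assoc]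
  termination_by a b => a + b

theorem DRG_succ_succ [DecidableEq α] (H G : List (List α)) (Nbhd : ℕ → Set (List α)) {y x : ℕ}
    (hy : y < H.length) (hx : x < G.length) :
    DRG H G Nbhd (brkPos H (y + 1)) (brkPos G (x + 1)) =
      DRG H G Nbhd (brkPos H y + 1) (brkPos G x + 1)
        + (lev (H.getD y []) (G.getD x []) : ℕ∞) := by
  rw [brkPos_succ, brkPos_succ, DRG_interior H G Nbhd hy hx _ _ le_rfl le_rfl, List.take_length,
    List.take_length]

theorem lineAlignCost_zero_right_le [DecidableEq α] (H G : List (List α))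
    (Nbhd : ℕ → Set (List α)) (y : ℕ) : lineAlignCost H G Nbhd y 0 ≤ brkPos H y := by
  induction y with
  | zero => simp [lineAlignCost, alignCost]
  | succ y ih =>
    rw [lineAlignCost] at ih
    rw [lineAlignCost, alignCost, brkPos_succ]
    omega

theorem lineAlignCost_zero_left_le [DecidableEq α] (H G : List (List α))
    (Nbhd : ℕ → Set (List α)) (x : ℕ) : lineAlignCost H G Nbhd 0 x ≤ brkPos G x := by
  induction x with
  | zero => simp [lineAlignCost, alignCost]
  | succ x ih =>
    rw [lineAlignCost] at ih
    rw [lineAlignCost, alignCost, brkPos_succ]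
    omega

theorem DRG_brkPos_eq_lineAlignCost [DecidableEq α] (H G : List (List α))
    (Nbhd : ℕ → Set (List α)) : ∀ y x, y ≤ H.length → x ≤ G.length →
      DRG H G Nbhd (brkPos H y + 1) (brkPos G x + 1) = (lineAlignCost H G Nbhd y x : ℕ∞)
  | 0, 0, hy, hx => by
    rw [DRG_brkPos H G Nbhd hy hx]
    simp [lineAlignCost, alignCost, brkPos, DRG_zero_left]
  | y + 1, 0, hy, hx => by
    have hle := lineAlignCost_zero_right_le H G Nbhd (y + 1)
    have ih := DRG_brkPos_eq_lineAlignCost H G Nbhd y 0 (by omega) hx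
    have h0 : brkPos G 0 = 0 := rfl
    rw [DRG_brkPos H G Nbhd hy hx, prevBrk_flat H hy, ih, h0, DRG_zero_right]
    rw [lineAlignCost, alignCost, ← lineAlignCost] at hle ⊢
    simpa using mod_cast hle
  | 0, x + 1, hy, hx => by
    have hle := lineAlignCost_zero_left_le H G Nbhd (x + 1)
    have ih := DRG_brkPos_eq_lineAlignCost H G Nbhd 0 x hy (by omega)
    have h0 : brkPos H 0 = 0 := rfl
    rw [DRG_brkPos H G Nbhd hy hx, prevBrk_flat G hx, ih, h0, DRG_zero_left]
    rw [lineAlignCost, alignCost, ← lineAlignCost] at hle ⊢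
    simpa using mod_cast hle
  | y + 1, x + 1, hy, hx => by
    have ih1 := DRG_brkPos_eq_lineAlignCost H G Nbhd y x (by omega) (by omega)
    have ih2 := DRG_brkPos_eq_lineAlignCost H G Nbhd y (x + 1) (by omega) hx
    have ih3 := DRG_brkPos_eq_lineAlignCost H G Nbhd (y + 1) x hy (by omega)
    rw [DRG_brkPos H G Nbhd hy hx, prevBrk_flat H hy, prevBrk_flat G hx, ih2, ih3,
      DRG_succ_succ H G Nbhd hy hx, ih1]
    conv_rhs => rw [lineAlignCost, alignCost, ← lineAlignCost]
    by_cases hP : H.getD y [] ∈ Nbhd x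
    · simp only [Nat.le_add_left, and_self, Nat.add_sub_cancel, true_imp_iff, hP, if_true]
      norm_cast
    · simp only [Nat.le_add_left, and_self, Nat.add_sub_cancel, true_imp_iff, hP, if_true,
        if_false, top_inf_eq]
      rw [← min_assoc, min_self]
      norm_cast
  termination_by y x => y + x

end Lines

/-- Minimal `LD^{R,G}` calculation: For arbitrary tuples of lines `H` and `G`,
an arbitrary neighborhood relation `𝒩` specifying for each ground-truth index `x` the set
`𝒩(G_x)` of hypothesis lines allowed to match `G_x`, and flattened sequences `h = f(H)`,
`g = f(G)`, the geometry-restricted dynamic-programming value equals the reading-order- and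
geometry-constrained minimal Levenshtein distance: `D^{R,G}(|h|,|g|) = LD^{R,G}(H,G)`. -/
theorem DRG_eq_LDRG {α : Type*} [DecidableEq α] (H G : List (List α))
    (Nbhd : ℕ → Set (List α)) :
    DRG H G Nbhd (flat H).length (flat G).length = (LDRG H G Nbhd : ℕ∞) := by
  rw [length_flat, length_flat, DRG_brkPos_eq_lineAlignCost H G Nbhd _ _ le_rfl le_rfl,
    LDRG_eq_lineAlignCost]
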